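/- If H is an S_3^+-free linear quadruple system on n vertices with exactly 5n/4 quadruples, then H is a vertex-disjoint union of copies of the Steiner system S(2,4,16); in particular every connected component of H is an S(2,4,16) on 16 vertices in which every vertex has degree 5. -/

import Mathlib

/-- A linear quadruple system on vertex set `Fin n`: a 4-uniform hypergraph in which
every pair of vertices lies in at most one quadruple (equivalently, two distinct
quadruples share at most one vertex). -/
structure LinearQuadSystem (n : ℕ) where
  edges : Finset (Finset (Fin n))
  card_four : ∀ e ∈ edges, e.card = 4
  linear : ∀ e ∈ edges, ∀ f ∈ edges, e ≠ f → (e ∩ f).card ≤ 1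

/-- `H` contains `S_3^+`: a linear 4-star with three quadruples `e₁, e₂, e₃` through a
common center `p` (pairwise meeting exactly in `p`), together with a fourth quadruple
`f` meeting `e₁` in exactly one vertex `q ≠ p` and disjoint from `e₂` and `e₃`. -/
def ContainsS3plus {n : ℕ} (H : LinearQuadSystem n) : Prop :=
  ∃ p : Fin n, ∃ e₁ e₂ e₃ f : Finset (Fin n),
    e₁ ∈ H.edges ∧ e₂ ∈ H.edges ∧ e₃ ∈ H.edges ∧ f ∈ H.edges ∧
    e₁ ∩ e₂ = {p} ∧ e₁ ∩ e₃ = {p} ∧ e₂ ∩ e₃ = {p} ∧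
    ∃ q : Fin n, q ≠ p ∧ f ∩ e₁ = {q} ∧ f ∩ e₂ = ∅ ∧ f ∩ e₃ = ∅

namespace LinearQuadSystem

variable {n : ℕ} (H : LinearQuadSystem n)

/-- The quadruples of `H` through the vertex `p`. -/
def star (p : Fin n) : Finset (Finset (Fin n)) := H.edges.filter (fun e => p ∈ e)

/-- The vertices covered by the quadruples through `p`. -/
def closedNbhd (p : Fin n) : Finset (Fin n) := (H.star p).biUnion id

variable {H}

theorem mem_star {p : Fin n} {e : Finset (Fin n)} : e ∈ H.star p ↔ e ∈ H.edges ∧ p ∈ e := by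
  simp [star]

theorem mem_closedNbhd {p x : Fin n} :
    x ∈ H.closedNbhd p ↔ ∃ e ∈ H.edges, p ∈ e ∧ x ∈ e := by
  simp [closedNbhd, mem_star, and_assoc]

theorem eq_of_mem_of_mem {e f : Finset (Fin n)} (he : e ∈ H.edges) (hf : f ∈ H.edges)
    {x y : Fin n} (hxy : x ≠ y) (hxe : x ∈ e) (hye : y ∈ e) (hxf : x ∈ f) (hyf : y ∈ f) :
    e = f := by
  by_contra hne
  have h := H.linear e he f hf hne
  rw [Finset.card_le_one] at h
  exact hxy (h x (by simp [hxe, hxf]) y (by simp [hye, hyf]))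

theorem inter_eq_singleton {e f : Finset (Fin n)} (he : e ∈ H.edges) (hf : f ∈ H.edges)
    (hne : e ≠ f) {x : Fin n} (hxe : x ∈ e) (hxf : x ∈ f) : e ∩ f = {x} := by
  ext y
  simp only [Finset.mem_inter, Finset.mem_singleton]
  constructor
  · rintro ⟨hye, hyf⟩
    by_contra hyx
    exact hne (eq_of_mem_of_mem he hf hyx hye hxe hyf hxf)
  · rintro rfl
    exact ⟨hxe, hxf⟩

theorem card_closedNbhd {p : Fin n} (hp : 0 < (H.star p).card) :
    (H.closedNbhd p).card = 3 * (H.star p).card + 1 := by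
  have hN : H.closedNbhd p = insert p ((H.star p).biUnion (fun e => e.erase p)) := by
    obtain ⟨e, he⟩ := Finset.card_pos.mp hp
    rw [mem_star] at he
    ext x
    by_cases hx : x = p
    · subst hx
      simpa [mem_closedNbhd] using ⟨e, he⟩
    · simp [mem_closedNbhd, mem_star, hx, and_assoc]
  rw [hN, Finset.card_insert_of_notMem (by simp), Finset.card_biUnion]
  · rw [Finset.sum_const_nat (m := 3)]
    · ring
    · intro e he
      rw [mem_star] at he
      rw [Finset.card_erase_of_mem he.2, H.card_four e he.1]
  · intro e he f hf hne
    rw [Finset.mem_coe, mem_star] at he hf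
    rw [Function.onFun, Finset.disjoint_left]
    intro x hxe hxf
    rw [Finset.mem_erase] at hxe hxf
    exact hne (eq_of_mem_of_mem he.1 hf.1 hxe.1 hxe.2 he.2 hxf.2 hf.2)

/-- A quadruple that meets the star of `p` without passing through `p` misses at most one
quadruple of the star. -/
theorem card_star_le (hfree : ¬ ContainsS3plus H) {p q : Fin n} {e f : Finset (Fin n)}
    (he : e ∈ H.edges) (hf : f ∈ H.edges) (hpe : p ∈ e) (hqe : q ∈ e) (hqf : q ∈ f)
    (hpf : p ∉ f) : (H.star p).card ≤ (f ∩ H.closedNbhd p).card + 1 := by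
  have hqp : q ≠ p := fun h => hpf (h ▸ hqf)
  have hmiss : ((H.star p).filter (fun g => ¬ (g ∩ f).Nonempty)).card ≤ 1 := by
    rw [Finset.card_le_one]
    intro a ha b hb
    simp only [Finset.mem_filter, mem_star, Finset.not_nonempty_iff_eq_empty] at ha hb
    by_contra hab
    have hef : q ∈ e ∩ f := by simp [hqe, hqf]
    have hea : e ≠ a := fun h => by simp [h, ha.2] at hef
    have heb : e ≠ b := fun h => by simp [h, hb.2] at hef
    have hfe : f ≠ e := fun h => hpf (h ▸ hpe)
    exact hfree ⟨p, e, a, b, f, he, ha.1.1, hb.1.1, hf,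
      inter_eq_singleton he ha.1.1 hea hpe ha.1.2, inter_eq_singleton he hb.1.1 heb hpe hb.1.2,
      inter_eq_singleton ha.1.1 hb.1.1 hab ha.1.2 hb.1.2, q, hqp,
      inter_eq_singleton hf he hfe hqf hqe, by rw [Finset.inter_comm]; exact ha.2,
      by rw [Finset.inter_comm]; exact hb.2⟩
  have hhit : ((H.star p).filter (fun g => (g ∩ f).Nonempty)).card ≤
      (f ∩ H.closedNbhd p).card := by
    have hex : ∀ g : Finset (Fin n), ∃ x, (g ∩ f).Nonempty → x ∈ g ∩ f := fun g => by
      by_cases h : (g ∩ f).Nonempty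
      · exact ⟨h.choose, fun _ => h.choose_spec⟩
      · exact ⟨p, fun h' => absurd h' h⟩
    choose c hc using hex
    refine Finset.card_le_card_of_injOn c ?_ ?_
    · intro g hg
      simp only [Finset.mem_coe, Finset.mem_filter, mem_star] at hg
      have hcg := Finset.mem_inter.mp (hc g hg.2)
      simp only [Finset.mem_coe, Finset.mem_inter, mem_closedNbhd]
      exact ⟨hcg.2, g, hg.1.1, hg.1.2, hcg.1⟩
    · intro g hg k hk hgk
      simp only [Finset.mem_coe, Finset.mem_filter, mem_star] at hg hk
      have hcg := Finset.mem_inter.mp (hc g hg.2)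
      have hck := Finset.mem_inter.mp (hc k hk.2)
      rw [← hgk] at hck
      exact eq_of_mem_of_mem hg.1.1 hk.1.1 (ne_of_mem_of_not_mem hcg.2 hpf) hcg.1 hg.1.2 hck.1 hk.1.2
  have := Finset.card_filter_add_card_filter_not (s := H.star p) (fun g => (g ∩ f).Nonempty)
  omega

theorem card_star_eq_one (hfree : ¬ ContainsS3plus H) {p q : Fin n} {e : Finset (Fin n)}
    (he : e ∈ H.edges) (hpe : p ∈ e) (hqe : q ∈ e) (hqp : q ≠ p) (hp : 6 ≤ (H.star p).card) :
    (H.star q).card = 1 := by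
  rw [Finset.card_eq_one]
  refine ⟨e, Finset.eq_singleton_iff_unique_mem.mpr ⟨mem_star.mpr ⟨he, hqe⟩, fun f hf => ?_⟩⟩
  rw [mem_star] at hf
  by_contra hne
  have hpf : p ∉ f := fun h => hne (eq_of_mem_of_mem hf.1 he hqp hf.2 h hqe hpe)
  have h₁ := card_star_le hfree he hf.1 hpe hqe hf.2 hpf
  have h₂ : (f ∩ H.closedNbhd p).card ≤ f.card := Finset.card_le_card Finset.inter_subset_left
  rw [H.card_four f hf.1] at h₂
  omega

theorem sum_inv_card_star (hfree : ¬ ContainsS3plus H) {e : Finset (Fin n)} (he : e ∈ H.edges) :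
    4 / 5 ≤ ∑ v ∈ e, ((H.star v).card : ℚ)⁻¹ ∧
      (∑ v ∈ e, ((H.star v).card : ℚ)⁻¹ ≤ 4 / 5 → ∀ v ∈ e, (H.star v).card = 5) := by
  have hpos : ∀ v ∈ e, 0 < (H.star v).card := fun v hv =>
    Finset.card_pos.mpr ⟨e, mem_star.mpr ⟨he, hv⟩⟩
  by_cases hbig : ∃ p ∈ e, 6 ≤ (H.star p).card
  · obtain ⟨p, hpe, hp⟩ := hbig
    have hsum : (3 : ℚ) ≤ ∑ v ∈ e, ((H.star v).card : ℚ)⁻¹ := by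
      calc (3 : ℚ) = ∑ v ∈ e.erase p, 1 := by
            simp [Finset.card_erase_of_mem hpe, H.card_four e he]
        _ = ∑ v ∈ e.erase p, ((H.star v).card : ℚ)⁻¹ := by
            refine Finset.sum_congr rfl fun v hv => ?_
            rw [Finset.mem_erase] at hv
            simp [card_star_eq_one hfree he hpe hv.2 hv.1 hp]
        _ ≤ _ := Finset.sum_le_sum_of_subset_of_nonneg (Finset.erase_subset _ _)
            fun _ _ _ => by positivity
    exact ⟨by linarith, fun h => by linarith⟩
  · push Not at hbig
    have hle : ∀ v ∈ e, (1 / 5 : ℚ) ≤ ((H.star v).card : ℚ)⁻¹ := fun v hv => by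
      have h₀ : (0 : ℚ) < (H.star v).card := by exact_mod_cast hpos v hv
      have h₅ : ((H.star v).card : ℚ) ≤ 5 := by exact_mod_cast Nat.lt_succ_iff.mp (hbig v hv)
      rw [← one_div]
      exact one_div_le_one_div_of_le h₀ h₅
    have hconst : ∑ v ∈ e, (1 / 5 : ℚ) = 4 / 5 := by
      simp [H.card_four e he]
      norm_num
    refine ⟨hconst ▸ Finset.sum_le_sum hle, fun h v hv => ?_⟩
    have heq := (Finset.sum_eq_sum_iff_of_le hle).mp
      (le_antisymm (Finset.sum_le_sum hle) (hconst ▸ h)) v hv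
    rw [one_div, inv_inj] at heq
    exact_mod_cast heq.symm

theorem sum_sum_inv_card_star :
    ∑ e ∈ H.edges, ∑ v ∈ e, ((H.star v).card : ℚ)⁻¹ =
      (Finset.univ.filter (fun v => 0 < (H.star v).card)).card := by
  rw [Finset.sum_comm' (t' := Finset.univ) (s' := fun v => H.star v)
    (by simp [mem_star]), Finset.card_filter, Nat.cast_sum]
  refine Finset.sum_congr rfl fun v _ => ?_
  rcases Nat.eq_zero_or_pos (H.star v).card with h | h
  · simp [h]
  · have : ((H.star v).card : ℚ) ≠ 0 := by exact_mod_cast h.ne'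
    simp [h, this]

theorem card_star_eq_five (hfree : ¬ ContainsS3plus H) (hcard : 4 * H.edges.card = 5 * n)
    (v : Fin n) : (H.star v).card = 5 := by
  have hcardQ : (4 : ℚ) * H.edges.card = 5 * n := by exact_mod_cast hcard
  have hconst : ∑ e ∈ H.edges, (4 / 5 : ℚ) = n := by
    rw [Finset.sum_const, nsmul_eq_mul]
    linarith
  have hle : ∀ e ∈ H.edges, (4 / 5 : ℚ) ≤ ∑ v ∈ e, ((H.star v).card : ℚ)⁻¹ :=
    fun e he => (sum_inv_card_star hfree he).1
  have hlow := Finset.sum_le_sum hle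
  have hup : (Finset.univ.filter (fun v => 0 < (H.star v).card)).card ≤ n := by
    simpa using Finset.card_filter_le (Finset.univ : Finset (Fin n)) (fun v => 0 < (H.star v).card)
  have hupQ : ((Finset.univ.filter (fun v => 0 < (H.star v).card)).card : ℚ) ≤ n := by
    exact_mod_cast hup
  have heq : ∑ e ∈ H.edges, (4 / 5 : ℚ) = ∑ e ∈ H.edges, ∑ v ∈ e, ((H.star v).card : ℚ)⁻¹ :=
    le_antisymm hlow (by rw [sum_sum_inv_card_star, hconst]; exact hupQ)
  have hall : (Finset.univ.filter (fun v => 0 < (H.star v).card)).card = n := by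
    rw [hconst, sum_sum_inv_card_star] at heq
    exact_mod_cast heq.symm
  have huniv : Finset.univ.filter (fun v => 0 < (H.star v).card) = Finset.univ :=
    Finset.eq_univ_of_card _ (by simpa using hall)
  have hv : 0 < (H.star v).card := by
    have := Finset.mem_univ v
    rw [← huniv, Finset.mem_filter] at this
    exact this.2
  obtain ⟨e, hev⟩ := Finset.card_pos.mp hv
  rw [mem_star] at hev
  exact (sum_inv_card_star hfree hev.1).2
    ((Finset.sum_eq_sum_iff_of_le hle).mp heq e hev.1).symm.le v hev.2

theorem subset_closedNbhd (hfree : ¬ ContainsS3plus H) {p q : Fin n} {f : Finset (Fin n)}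
    (hp : (H.star p).card = 5) (hq : q ∈ H.closedNbhd p) (hf : f ∈ H.edges) (hqf : q ∈ f) :
    f ⊆ H.closedNbhd p := by
  by_cases hpf : p ∈ f
  · exact fun x hx => mem_closedNbhd.mpr ⟨f, hf, hpf, hx⟩
  · obtain ⟨e, he, hpe, hqe⟩ := mem_closedNbhd.mp hq
    have h := card_star_le hfree he hf hpe hqe hqf hpf
    rw [← Finset.inter_eq_left]
    refine Finset.eq_of_subset_of_card_le Finset.inter_subset_left ?_
    rw [H.card_four f hf]
    omega

theorem closedNbhd_eq (hfree : ¬ ContainsS3plus H) (hdeg : ∀ v, (H.star v).card = 5)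
    {p q : Fin n} (hq : q ∈ H.closedNbhd p) : H.closedNbhd q = H.closedNbhd p := by
  refine Finset.eq_of_subset_of_card_le (fun x hx => ?_) ?_
  · obtain ⟨f, hf, hqf, hxf⟩ := mem_closedNbhd.mp hx
    exact subset_closedNbhd hfree (hdeg p) hq hf hqf hxf
  · rw [card_closedNbhd (by simp [hdeg]), card_closedNbhd (by simp [hdeg]), hdeg, hdeg]

theorem self_mem_closedNbhd {p : Fin n} (hp : 0 < (H.star p).card) : p ∈ H.closedNbhd p := by
  obtain ⟨e, he⟩ := Finset.card_pos.mp hp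
  rw [mem_star] at he
  exact mem_closedNbhd.mpr ⟨e, he.1, he.2, he.2⟩

end LinearQuadSystem

/-- an `S_3^+`-free linear quadruple system on `n` vertices with exactly
`5n/4` quadruples (i.e. `4 · |E(H)| = 5n`) is a vertex-disjoint union of copies of the
Steiner system `S(2,4,16)`: the vertex set splits into pairwise disjoint 16-element
classes, every quadruple lies inside one class, within each class every pair of
vertices lies in exactly one quadruple of `H`, and every vertex has degree 5. -/
theorem linear_turan_S3plus_extremal (n : ℕ) (H : LinearQuadSystem n)
    (hfree : ¬ ContainsS3plus H) (hcard : 4 * H.edges.card = 5 * n) :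
    ∃ P : Finset (Finset (Fin n)),
      (∀ A ∈ P, A.card = 16) ∧
      (∀ A ∈ P, ∀ B ∈ P, A ≠ B → Disjoint A B) ∧
      P.biUnion id = Finset.univ ∧
      (∀ e ∈ H.edges, ∃ A ∈ P, e ⊆ A) ∧
      (∀ A ∈ P, ∀ x ∈ A, ∀ y ∈ A, x ≠ y →
        ∃! e : Finset (Fin n), e ∈ H.edges ∧ e ⊆ A ∧ x ∈ e ∧ y ∈ e) ∧
      (∀ v : Fin n, (H.edges.filter (fun e => v ∈ e)).card = 5) := by
  have hdeg := LinearQuadSystem.card_star_eq_five hfree hcard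
  have hself : ∀ v, v ∈ H.closedNbhd v := fun v =>
    LinearQuadSystem.self_mem_closedNbhd (by simp [hdeg])
  refine ⟨Finset.univ.image H.closedNbhd, ?_, ?_, ?_, ?_, ?_, hdeg⟩
  · simp only [Finset.forall_mem_image]
    intro p _
    rw [LinearQuadSystem.card_closedNbhd (by simp [hdeg]), hdeg]
  · simp only [Finset.forall_mem_image]
    intro p _ q _ hne
    rw [Finset.disjoint_left]
    intro x hxp hxq
    exact hne ((LinearQuadSystem.closedNbhd_eq hfree hdeg hxp).symm.trans
      (LinearQuadSystem.closedNbhd_eq hfree hdeg hxq))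
  · ext x
    simpa using ⟨x, hself x⟩
  · intro e he
    obtain ⟨p, hp⟩ := Finset.card_pos.mp (by simp [H.card_four e he] : 0 < e.card)
    exact ⟨H.closedNbhd p, Finset.mem_image_of_mem _ (Finset.mem_univ p),
      fun x hx => LinearQuadSystem.mem_closedNbhd.mpr ⟨e, he, hp, hx⟩⟩
  · simp only [Finset.forall_mem_image]
    intro p _ x hx y hy hxy
    rw [← LinearQuadSystem.closedNbhd_eq hfree hdeg hx] at hy
    obtain ⟨e, he, hxe, hye⟩ := LinearQuadSystem.mem_closedNbhd.mp hy
    exact ⟨e, ⟨he, LinearQuadSystem.subset_closedNbhd hfree (hdeg p) hx he hxe, hxe, hye⟩,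
      fun f hf => LinearQuadSystem.eq_of_mem_of_mem hf.1 he hxy hf.2.2.1 hf.2.2.2 hxe hye⟩
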